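/- Let M be a model based on a rooted finitely M-generated descriptive frame F for K4.3. Then: (a) every degenerate cluster of F is maximal in M; (b) a cluster of F is maximal in M iff it is either the final cluster or has an immediate <_R-successor; (c) a cluster of F is definable in M iff it is maximal in M. Consequently, limit clusters are neither definable in M nor degenerate, while every non-limit cluster is definable in M. -/

import Mathlib

/-! ## Modal formulas -/

inductive MF : Type
  | var : ℕ → MF
  | top : MF
  | bot : MF
  | neg : MF → MF
  | and : MF → MF → MF
  | dia : MF → MF
deriving DecidableEq

namespace MF

def or (φ ψ : MF) : MF := .neg (.and (.neg φ) (.neg ψ))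
def imp (φ ψ : MF) : MF := MF.or (.neg φ) ψ
def box (φ : MF) : MF := .neg (.dia (.neg φ))
def diaPlus (φ : MF) : MF := MF.or φ (.dia φ)
def boxPlus (φ : MF) : MF := .and φ (box φ)

/-- the propositional variables occurring in a formula -/
def vars : MF → Finset ℕ
  | .var p => {p}
  | .top => ∅
  | .bot => ∅
  | .neg φ => vars φ
  | .and φ ψ => vars φ ∪ vars ψ
  | .dia φ => vars φ

/-- the signature of a formula -/
def sig (φ : MF) : Set ℕ := ↑(vars φ)

/-- subformulas -/
def subs : MF → Finset MF
  | .var p => {.var p}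
  | .top => {.top}
  | .bot => {.bot}
  | .neg φ => insert (.neg φ) (subs φ)
  | .and φ ψ => insert (.and φ ψ) (subs φ ∪ subs ψ)
  | .dia φ => insert (.dia φ) (subs φ)

/-- `|φ|`: the number of subformulas of `φ` together with their negations -/
def size (φ : MF) : ℕ := ((subs φ) ∪ (subs φ).image MF.neg).card

/-- uniform substitution -/
def substVar (s : ℕ → MF) : MF → MF
  | .var p => s p
  | .top => .top
  | .bot => .bot
  | .neg φ => .neg (substVar s φ)
  | .and φ ψ => .and (substVar s φ) (substVar s ψ)
  | .dia φ => .dia (substVar s φ)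

end MF

/-- a Boolean evaluation of modal formulas (treating `◇`-formulas and variables as atoms) -/
def BoolEval (f : MF → Prop) : Prop :=
  f .top ∧ ¬ f .bot ∧ (∀ φ, f (.neg φ) ↔ ¬ f φ) ∧ (∀ φ ψ, f (.and φ ψ) ↔ (f φ ∧ f ψ))

/-- Boolean tautologies in the modal language -/
def MF.Tautology (φ : MF) : Prop := ∀ f : MF → Prop, BoolEval f → f φ

/-- normal modal logics -/
structure IsNormalLogic (L : Set MF) : Prop where
  taut : ∀ φ, φ.Tautology → φ ∈ L
  axK : MF.imp (MF.box (MF.imp (.var 0) (.var 1)))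
          (MF.imp (MF.box (.var 0)) (MF.box (.var 1))) ∈ L
  mp : ∀ φ ψ, φ ∈ L → MF.imp φ ψ ∈ L → ψ ∈ L
  subst : ∀ φ s, φ ∈ L → MF.substVar s φ ∈ L
  nec : ∀ φ, φ ∈ L → MF.box φ ∈ L

/-- the smallest normal modal logic containing `Γ` -/
def NormClosure (Γ : Set MF) : Set MF :=
  {φ | ∀ L : Set MF, IsNormalLogic L → Γ ⊆ L → φ ∈ L}

def ax4 : MF := MF.imp (MF.box (.var 0)) (MF.box (MF.box (.var 0)))
def ax43 : MF := MF.or (MF.box (MF.imp (MF.boxPlus (.var 0)) (.var 1)))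
                       (MF.box (MF.imp (MF.boxPlus (.var 1)) (.var 0)))
def axGL : MF := MF.imp (MF.box (MF.imp (MF.box (.var 0)) (.var 0))) (MF.box (.var 0))

def K4 : Set MF := NormClosure {ax4}
def K43 : Set MF := NormClosure {ax4, ax43}
def GL3 : Set MF := NormClosure {ax4, ax43, axGL}

/-! ## General frames and models -/

/-- a (general) frame: a relation together with a collection of "internal" sets -/
structure KFrame (W : Type) where
  R : W → W → Prop
  P : Set (Set W)

namespace KFrame

variable {W : Type}

def dia (F : KFrame W) (X : Set W) : Set W := {x | ∃ y ∈ X, F.R x y}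

/-- the conditions making `F` a general frame -/
def IsGeneral (F : KFrame W) : Prop :=
  Nonempty W ∧ ∅ ∈ F.P ∧ Set.univ ∈ F.P ∧
    (∀ X ∈ F.P, ∀ Y ∈ F.P, X ∩ Y ∈ F.P) ∧
    (∀ X ∈ F.P, Xᶜ ∈ F.P) ∧ (∀ X ∈ F.P, F.dia X ∈ F.P)

/-- differentiated, tight and compact -/
def Descriptive (F : KFrame W) : Prop :=
  (∀ x y : W, (∀ X ∈ F.P, x ∈ X ↔ y ∈ X) → x = y) ∧
  (∀ x y : W, F.R x y ↔ ∀ X ∈ F.P, y ∈ X → x ∈ F.dia X) ∧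
  (∀ 𝒳 : Set (Set W), 𝒳 ⊆ F.P →
    (∀ 𝒴 : Set (Set W), 𝒴 ⊆ 𝒳 → 𝒴.Finite → (⋂₀ 𝒴).Nonempty) → (⋂₀ 𝒳).Nonempty)

/-- `x` is a root of `F` (every point is reachable from `x` via the reflexive closure) -/
def Rooted (F : KFrame W) (x : W) : Prop := ∀ y : W, x = y ∨ F.R x y

/-- the strict order on clusters: `C(x) <_R C(y)` -/
def clLT (F : KFrame W) (x y : W) : Prop := F.R x y ∧ ¬ F.R y x

/-- the cluster of a point -/
def cluster (F : KFrame W) (x : W) : Set W := insert x {y | F.R x y ∧ F.R y x}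

def clLE (F : KFrame W) (x y : W) : Prop := y ∈ F.cluster x ∨ F.clLT x y

/-- the closed interval of clusters `[C(x), C(y)]` -/
def interval (F : KFrame W) (x y : W) : Set W := {z | F.clLE x z ∧ F.clLE z y}

/-- `C(x)` is the final cluster -/
def FinalCl (F : KFrame W) (x : W) : Prop := ∀ y, ¬ F.clLT x y

/-- `C(y)` is an immediate successor of `C(x)` -/
def ImmSucc (F : KFrame W) (x y : W) : Prop :=
  F.clLT x y ∧ ¬ ∃ z, F.clLT x z ∧ F.clLT z y

/-- `C(x)` is a limit cluster -/
def LimitCl (F : KFrame W) (x : W) : Prop := ¬ F.FinalCl x ∧ ¬ ∃ y, F.ImmSucc x y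

/-- `C(x)` is a degenerate cluster -/
def DegenerateCl (F : KFrame W) (x : W) : Prop := ¬ F.R x x

end KFrame

/-- the closure of a family of sets under `∩`, complement and `◇` -/
inductive genBy {W : Type} (R : W → W → Prop) (G : Set (Set W)) : Set W → Prop
  | basic {X : Set W} : X ∈ G → genBy R G X
  | empty : genBy R G ∅
  | univ : genBy R G Set.univ
  | inter {X Y : Set W} : genBy R G X → genBy R G Y → genBy R G (X ∩ Y)
  | compl {X : Set W} : genBy R G X → genBy R G Xᶜ
  | dia {X : Set W} : genBy R G X → genBy R G {x | ∃ y ∈ X, R x y}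

def KFrame.GeneratedBy {W : Type} (F : KFrame W) (G : Set (Set W)) : Prop :=
  F.P = {X | genBy F.R G X}

def KFrame.FinGenerated {W : Type} (F : KFrame W) : Prop :=
  ∃ G : Set (Set W), G.Finite ∧ F.GeneratedBy G

def KFrame.NGenerated {W : Type} (F : KFrame W) (n : ℕ) : Prop :=
  ∃ G : Set (Set W), G.Finite ∧ G.ncard = n ∧ F.GeneratedBy G

/-- a model: a frame with a valuation -/
structure KModel (W : Type) where
  F : KFrame W
  v : ℕ → Set W

namespace KModel

variable {W : Type}

/-- the frame is a general frame and all values of the valuation are internal -/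
def IsModel (M : KModel W) : Prop := M.F.IsGeneral ∧ ∀ p, M.v p ∈ M.F.P

/-- truth at a point -/
def sat (M : KModel W) : W → MF → Prop
  | x, .var p => x ∈ M.v p
  | _, .top => True
  | _, .bot => False
  | x, .neg φ => ¬ sat M x φ
  | x, .and φ ψ => sat M x φ ∧ sat M x ψ
  | x, .dia φ => ∃ y, M.F.R x y ∧ sat M y φ

/-- a set is definable in `M` -/
def Definable (M : KModel W) (X : Set W) : Prop := ∃ φ : MF, X = {x | M.sat x φ}

/-- every internal set is definable in `M` -/
def MGenerated (M : KModel W) : Prop := ∀ X ∈ M.F.P, M.Definable X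

/-- finitely `M`-generated -/
def FinMGenerated (M : KModel W) : Prop := M.MGenerated ∧ M.F.FinGenerated

/-- the σ-type of a point: all σ-formulas true at it -/
def stype (M : KModel W) (σ : Set ℕ) (x : W) : Set MF := {φ | φ.sig ⊆ σ ∧ M.sat x φ}

/-- `x` is `Γ`-maximal in `M` -/
def MaxFor (M : KModel W) (Γ : Set MF) (x : W) : Prop :=
  (∀ γ ∈ Γ, M.sat x γ) ∧ ∀ y, M.F.R x y → (∀ γ ∈ Γ, M.sat y γ) → M.F.R y x

/-- the cluster `C(x)` is `μ`-maximal in `M` -/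
def ClMuMax (M : KModel W) (μ : MF) (x : W) : Prop := ∃ z ∈ M.F.cluster x, M.MaxFor {μ} z

/-- the cluster `C(x)` is maximal in `M` -/
def ClMax (M : KModel W) (x : W) : Prop := ∃ μ : MF, M.ClMuMax μ x

/-- the cluster `C(x)` is σ-maximal in `M` -/
def ClSigMax (M : KModel W) (σ : Set ℕ) (x : W) : Prop :=
  ∃ μ : MF, μ.sig ⊆ σ ∧ M.ClMuMax μ x

/-- the cluster `C(x)` is definable in `M` -/
def ClDefinable (M : KModel W) (x : W) : Prop := M.Definable (M.F.cluster x)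

/-- `◇ t^σ_M(x) ⊆ t^σ_M(y)` -/
def diaSubset (M : KModel W) (σ : Set ℕ) (x y : W) : Prop :=
  ∀ φ ∈ M.stype σ x, MF.dia φ ∈ M.stype σ y

/-- the σ-block of a point -/
def sblockOf (M : KModel W) (σ : Set ℕ) (x : W) : Set W :=
  {y | (M.diaSubset σ x x ∧ M.diaSubset σ y x ∧ M.diaSubset σ x y) ∨
       (¬ M.diaSubset σ x x ∧ y = x)}

/-- a σ-block in `M` -/
def IsSBlock (M : KModel W) (σ : Set ℕ) (b : Set W) : Prop := ∃ x, b = M.sblockOf σ x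

/-- a degenerate σ-block in `M` -/
def DegenSBlock (M : KModel W) (σ : Set ℕ) (b : Set W) : Prop :=
  ∃ x, b = M.sblockOf σ x ∧ ¬ M.diaSubset σ x x

end KModel

/-- validity of a formula on a frame -/
def KFrame.Valid {W : Type} (F : KFrame W) (φ : MF) : Prop :=
  ∀ v : ℕ → Set W, (∀ p, v p ∈ F.P) → ∀ x, (KModel.mk F v).sat x φ

/-- `F` is a frame for the logic `L` -/
def KFrame.IsFrameFor {W : Type} (F : KFrame W) (L : Set MF) : Prop :=
  ∀ φ ∈ L, F.Valid φ

/-! ## Bisimulations -/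

def IsBisim {W₁ W₂ : Type} (σ : Set ℕ) (M₁ : KModel W₁) (M₂ : KModel W₂)
    (β : W₁ → W₂ → Prop) : Prop :=
  ∀ x₁ x₂, β x₁ x₂ →
    (∀ p ∈ σ, x₁ ∈ M₁.v p ↔ x₂ ∈ M₂.v p) ∧
    (∀ y₁, M₁.F.R x₁ y₁ → ∃ y₂, M₂.F.R x₂ y₂ ∧ β y₁ y₂) ∧
    (∀ y₂, M₂.F.R x₂ y₂ → ∃ y₁, M₁.F.R x₁ y₁ ∧ β y₁ y₂)

def Bisimilar {W₁ W₂ : Type} (σ : Set ℕ) (M₁ : KModel W₁) (x₁ : W₁)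
    (M₂ : KModel W₂) (x₂ : W₂) : Prop :=
  ∃ β, IsBisim σ M₁ M₂ β ∧ β x₁ x₂

/-- the two points satisfy the same variables of `σ` -/
def SigAgree {W₁ W₂ : Type} (σ : Set ℕ) (M₁ : KModel W₁) (x₁ : W₁)
    (M₂ : KModel W₂) (x₂ : W₂) : Prop :=
  ∀ p ∈ σ, x₁ ∈ M₁.v p ↔ x₂ ∈ M₂.v p

/-- the two points have the same σ-type -/
def TypeEquiv {W₁ W₂ : Type} (σ : Set ℕ) (M₁ : KModel W₁) (x₁ : W₁)
    (M₂ : KModel W₂) (x₂ : W₂) : Prop :=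
  ∀ φ : MF, φ.sig ⊆ σ → (M₁.sat x₁ φ ↔ M₂.sat x₂ φ)

/-! ## Interpolants -/

def IsInterpolant (L : Set MF) (φ₁ φ₂ ι : MF) : Prop :=
  ι.sig ⊆ φ₁.sig ∩ φ₂.sig ∧ MF.imp φ₁ ι ∈ L ∧ MF.imp ι φ₂ ∈ L

def NoInterpolant (L : Set MF) (φ₁ φ₂ : MF) : Prop := ¬ ∃ ι, IsInterpolant L φ₁ φ₂ ι

def HasCIP (L : Set MF) : Prop :=
  ∀ φ₁ φ₂ : MF, MF.imp φ₁ φ₂ ∈ L → ∃ ι, IsInterpolant L φ₁ φ₂ ι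

/-- `k(φ₁,φ₂) = 3 + 3·max(|φ₁|,|φ₂|)` -/
def kBound (φ₁ φ₂ : MF) : ℕ := 3 + 3 * max φ₁.size φ₂.size

/-- the conjunction of a finite list of formulas -/
def conjList : List MF → MF
  | [] => .top
  | φ :: l => .and φ (conjList l)

/-! ## d-persistence and cofinal subframe logics -/

def DPersistent (L : Set MF) : Prop :=
  ∀ (W : Type) (F : KFrame W), F.IsGeneral → F.Descriptive → F.IsFrameFor L →
    KFrame.IsFrameFor ⟨F.R, (Set.univ : Set (Set W))⟩ L

def CofinalSet {W : Type} (F : KFrame W) (S : Set W) : Prop :=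
  ∀ x ∈ S, ∀ y, F.R x y → y ∈ S ∨ ∃ z ∈ S, F.R y z

/-- the subframe of `F` with underlying set `S` and internal sets `Q` -/
def subframeOn {W : Type} (F : KFrame W) (S : Set W) (Q : Set (Set W)) : KFrame S :=
  ⟨fun a b => F.R a.1 b.1, {T | ∃ X ∈ Q, T = (Subtype.val ⁻¹' X : Set S)}⟩

/-- the class of general frames of `L` is closed under cofinal subframes -/
def CofinalSubframeLogic (L : Set MF) : Prop :=
  ∀ (W : Type) (F : KFrame W) (S : Set W) (Q : Set (Set W)),
    F.IsGeneral → F.IsFrameFor L → Q ⊆ F.P → (∀ X ∈ Q, X ⊆ S) →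
    (subframeOn F S Q).IsGeneral → CofinalSet F S →
    (subframeOn F S Q).IsFrameFor L

/-- the subframe of `F` generated by a point `x` -/
def KFrame.genSub {W : Type} (F : KFrame W) (x : W) :
    KFrame {y : W // x = y ∨ F.R x y} :=
  ⟨fun a b => F.R a.1 b.1, {S | ∃ X ∈ F.P, S = Subtype.val ⁻¹' X}⟩

namespace KFrame

variable {W : Type} {F : KFrame W}

theorem IsGeneral.union_mem (hF : F.IsGeneral) {X Y : Set W} (hX : X ∈ F.P) (hY : Y ∈ F.P) :
    X ∪ Y ∈ F.P := by
  obtain ⟨_, _, _, hi, hc, _⟩ := hF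
  have h := hc _ (hi _ (hc _ hX) _ (hc _ hY))
  rwa [← Set.compl_union, compl_compl] at h

/-- In a descriptive frame, a point `z` outside the reflexive closure of `R` at `y` can be
separated from it by an internal set. -/
theorem Descriptive.exists_separating (hF : F.IsGeneral) (hd : F.Descriptive) {y z : W}
    (hne : y ≠ z) (hR : ¬ F.R y z) : ∃ Z ∈ F.P, z ∈ Z ∧ y ∉ Z ∧ y ∉ F.dia Z := by
  obtain ⟨_, _, _, hi, hc, _⟩ := hF
  obtain ⟨hdif, htig, _⟩ := hd
  obtain ⟨A, hA, hzA, hyA⟩ : ∃ A ∈ F.P, z ∈ A ∧ y ∉ A := by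
    by_contra! h
    refine hne (hdif y z fun X hX => ⟨fun hy => ?_, h X hX⟩)
    by_contra hz
    exact h _ (hc X hX) hz hy
  rw [htig] at hR
  push Not at hR
  obtain ⟨B, hB, hzB, hyB⟩ := hR
  exact ⟨A ∩ B, hi _ hA _ hB, ⟨hzA, hzB⟩, fun h => hyA h.1,
    fun ⟨w, hw, hyw⟩ => hyB ⟨w, hw.2, hyw⟩⟩

theorem IsFrameFor.transitive (hF : F.IsGeneral) (hd : F.Descriptive) (hK : F.IsFrameFor K43)
    {x y z : W} (hxy : F.R x y) (hyz : F.R y z) : F.R x z := by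
  obtain ⟨_, _, _, _, hc, _⟩ := hF
  rw [hd.2.1]
  intro Z hZ hz
  have h := hK ax4 (fun L _ hΓ => hΓ (by simp)) (fun _ => Zᶜ) (fun _ => hc _ hZ) x
  simp only [ax4, MF.imp, MF.or, MF.box, KModel.sat, Set.mem_compl_iff] at h
  by_contra hx
  refine h ⟨fun h' => h' fun ⟨w, hw, hwZ⟩ => hx ⟨w, not_not.1 hwZ, hw⟩, fun h' => h' ?_⟩
  exact ⟨y, hxy, fun h'' => h'' ⟨z, hyz, not_not.2 hz⟩⟩

theorem IsFrameFor.connected (hF : F.IsGeneral) (hd : F.Descriptive) (hK : F.IsFrameFor K43)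
    {x y z : W} (hxy : F.R x y) (hxz : F.R x z) : y = z ∨ F.R y z ∨ F.R z y := by
  by_contra! hcon
  obtain ⟨hne, hyz, hzy⟩ := hcon
  obtain ⟨Z, hZ, hzZ, hyZ, hydZ⟩ := hd.exists_separating hF hne hyz
  obtain ⟨Y, hY, hyY, hzY, hzdY⟩ := hd.exists_separating hF hne.symm hzy
  obtain ⟨_, _, _, _, hc, _⟩ := hF
  have h := hK ax43 (fun L _ hΓ => hΓ (by simp)) (fun n => if n = 0 then Zᶜ else Yᶜ)
    (fun n => by split_ifs; exacts [hc _ hZ, hc _ hY]) x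
  simp only [ax43, MF.imp, MF.or, MF.box, MF.boxPlus, KModel.sat, if_true, one_ne_zero, if_false,
    Set.mem_compl_iff] at h
  refine h ⟨fun h' => h' ⟨y, hxy, fun h'' => h'' ⟨fun k => k ⟨hyZ, ?_⟩, fun k => k hyY⟩⟩,
    fun h' => h' ⟨z, hxz, fun h'' => h'' ⟨fun k => k ⟨hzY, ?_⟩, fun k => k hzZ⟩⟩⟩
  · rintro ⟨w, hw, hwZ⟩
    exact hydZ ⟨w, not_not.1 hwZ, hw⟩
  · rintro ⟨w, hw, hwY⟩
    exact hzdY ⟨w, not_not.1 hwY, hw⟩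

theorem IsFrameFor.comparable (hF : F.IsGeneral) (hd : F.Descriptive) (hK : F.IsFrameFor K43)
    (hroot : ∃ r, F.Rooted r) (y z : W) : y = z ∨ F.R y z ∨ F.R z y := by
  obtain ⟨r, hr⟩ := hroot
  rcases hr y with rfl | hy
  · exact (hr z).imp_right .inl
  rcases hr z with rfl | hz
  · exact .inr (.inr hy)
  exact hK.connected hF hd hy hz

/-- `z` is an `R`-maximal point of `X`, up to its cluster. -/
def MaxIn (F : KFrame W) (X : Set W) (z : W) : Prop :=
  z ∈ X ∧ ∀ y, F.R z y → y ∈ X → F.R y z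

/-- The reflexive `R`-downset of a point. -/
def lower (F : KFrame W) (x : W) : Set W := {y | y = x ∨ F.R y x}

theorem lower_mem_of_maxIn (hF : F.IsGeneral)
    (ht : ∀ {x y z : W}, F.R x y → F.R y z → F.R x z)
    (hcmp : ∀ y z : W, y = z ∨ F.R y z ∨ F.R z y) {x z : W} {X : Set W} (hX : X ∈ F.P)
    (hz : z ∈ F.cluster x) (hm : F.MaxIn X z) : F.lower x ∈ F.P := by
  have hzx : z = x ∨ F.R z x := hz.imp_right And.right
  have hxz : x = z ∨ F.R x z := hz.imp Eq.symm And.left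
  have hXx : ∀ y ∈ X, y ∈ F.lower x := by
    intro y hy
    have hyz : y = z ∨ F.R y z := by
      rcases hcmp y z with h | h | h
      exacts [.inl h, .inr h, .inr (hm.2 y h hy)]
    rcases hyz with rfl | h
    · exact hzx
    · exact .inr (hzx.elim (fun e => e ▸ h) (ht h))
  have heq : F.lower x = X ∪ F.dia X := by
    ext y
    constructor
    · rintro (rfl | h)
      · exact hxz.elim (fun e => .inl (e ▸ hm.1)) fun h => .inr ⟨z, hm.1, h⟩
      · exact .inr ⟨z, hm.1, hxz.elim (fun e => e ▸ h) (ht h)⟩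
    · rintro (h | ⟨w, hw, hyw⟩)
      · exact hXx y h
      · exact .inr ((hXx w hw).elim (fun e => e ▸ hyw) (ht hyw))
  rw [heq]
  exact hF.union_mem hX (hF.2.2.2.2.2 X hX)

theorem maxIn_of_lower {x : W} : F.MaxIn (F.lower x) x :=
  ⟨.inl rfl, fun _ hxy hy => hy.elim (fun e => by rwa [e] at hxy ⊢) id⟩

theorem exists_maxIn_of_irrefl (hd : F.Descriptive) {x : W} (hx : ¬ F.R x x) :
    ∃ X ∈ F.P, F.MaxIn X x := by
  rw [hd.2.1] at hx
  push Not at hx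
  obtain ⟨X, hX, hxX, hxd⟩ := hx
  exact ⟨X, hX, hxX, fun y hxy hy => (hxd ⟨y, hy, hxy⟩).elim⟩

theorem ImmSucc.exists_maxIn (hF : F.IsGeneral) (hd : F.Descriptive)
    (hcmp : ∀ y z : W, y = z ∨ F.R y z ∨ F.R z y) {x y : W} (h : F.ImmSucc x y) :
    ∃ X ∈ F.P, F.MaxIn X x := by
  obtain ⟨⟨hxy, hyx⟩, hno⟩ := h
  obtain ⟨X, hX, hxX, hyX, hydX⟩ :=
    hd.exists_separating hF (fun e => hyx (by rw [e] at hxy ⊢; exact hxy)) hyx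
  refine ⟨X, hX, hxX, fun z hxz hz => ?_⟩
  by_contra hzx
  rcases hcmp y z with rfl | hyz | hzy
  · exact hyX hz
  · exact hydX ⟨z, hz, hyz⟩
  · exact hno ⟨z, ⟨hxz, hzx⟩, hzy, fun hyz => hydX ⟨z, hz, hyz⟩⟩

/-- A nonempty internal set of a linear descriptive frame has an `R`-least point. -/
theorem exists_least (hF : F.IsGeneral) (hd : F.Descriptive)
    (ht : ∀ {x y z : W}, F.R x y → F.R y z → F.R x z)
    (hcmp : ∀ y z : W, y = z ∨ F.R y z ∨ F.R z y) {U : Set W} (hU : U ∈ F.P)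
    (hne : U.Nonempty) : ∃ y ∈ U, ∀ z ∈ U, y = z ∨ F.R y z := by
  have hdia := hF.2.2.2.2.2
  have hfin : ∀ 𝒴 : Set (Set W), 𝒴.Finite →
      𝒴 ⊆ {V | V = U ∨ ∃ Z ∈ F.P, (Z ∩ U).Nonempty ∧ V = Z ∪ F.dia Z} →
      ∃ y ∈ U, ∀ V ∈ 𝒴, ∀ w ∈ U, (w = y ∨ F.R w y) → w ∈ V := by
    intro 𝒴 h𝒴
    induction 𝒴, h𝒴 using Set.Finite.induction_on with
    | empty =>
      obtain ⟨u, hu⟩ := hne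
      exact fun _ => ⟨u, hu, by simp⟩
    | insert _ _ ih =>
      intro hsub
      obtain ⟨y, hyU, hy⟩ := ih fun V hV => hsub (.inr hV)
      rcases hsub (.inl rfl) with rfl | ⟨Z, hZ, ⟨z, hzZ, hzU⟩, rfl⟩
      · exact ⟨y, hyU, fun V hV w hw hwy => hV.elim (fun e => e ▸ hw) fun hV => hy V hV w hw hwy⟩
      · have hZw : ∀ w, (w = z ∨ F.R w z) → w ∈ Z ∪ F.dia Z := fun w hw =>
          hw.elim (fun e => .inl (e ▸ hzZ)) fun h => .inr ⟨z, hzZ, h⟩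
        rcases hcmp y z with rfl | hyz | hzy
        · refine ⟨y, hyU, ?_⟩
          rintro V (rfl | hV) w hw hwy
          exacts [hZw w hwy, hy V hV w hw hwy]
        · refine ⟨y, hyU, ?_⟩
          rintro V (rfl | hV) w hw hwy
          exacts [hZw w (.inr (hwy.elim (fun e => e ▸ hyz) fun h => ht h hyz)), hy V hV w hw hwy]
        · refine ⟨z, hzU, ?_⟩
          rintro V (rfl | hV) w hw hwz
          exacts [hZw w hwz,
            hy V hV w hw (.inr (hwz.elim (fun e => e ▸ hzy) fun h => ht h hzy))]
  obtain ⟨y, hy⟩ := hd.2.2 {V | V = U ∨ ∃ Z ∈ F.P, (Z ∩ U).Nonempty ∧ V = Z ∪ F.dia Z}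
    (by
      rintro V (rfl | ⟨Z, hZ, _, rfl⟩)
      exacts [hU, hF.union_mem hZ (hdia Z hZ)])
    (fun 𝒴 hsub h𝒴 => by
      obtain ⟨y, hyU, hy⟩ := hfin 𝒴 h𝒴 hsub
      exact ⟨y, fun V hV => hy V hV y hyU (.inl rfl)⟩)
  refine ⟨y, hy U (.inl rfl), fun z hz => ?_⟩
  by_contra! hcon
  obtain ⟨Z, hZ, hzZ, hyZ, hydZ⟩ := hd.exists_separating hF hcon.1 hcon.2
  exact (hy _ (.inr ⟨Z, hZ, ⟨z, hzZ, hz⟩, rfl⟩)).elim hyZ hydZ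

theorem final_or_immSucc_of_lower_mem (hF : F.IsGeneral) (hd : F.Descriptive)
    (ht : ∀ {x y z : W}, F.R x y → F.R y z → F.R x z)
    (hcmp : ∀ y z : W, y = z ∨ F.R y z ∨ F.R z y) {x : W} (hx : F.lower x ∈ F.P) :
    F.FinalCl x ∨ ∃ y, F.ImmSucc x y := by
  have hmem : ∀ y, y ∈ (F.lower x)ᶜ ↔ F.clLT x y := by
    intro y
    constructor
    · intro hy
      rcases hcmp x y with rfl | h | h
      · exact (hy (.inl rfl)).elim
      · exact ⟨h, fun h' => hy (.inr h')⟩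
      · exact (hy (.inr h)).elim
    · rintro ⟨h, h'⟩ (rfl | hy)
      exacts [h' h, h' hy]
  by_cases hfin : F.FinalCl x
  · exact .inl hfin
  · right
    rw [FinalCl] at hfin
    push Not at hfin
    obtain ⟨u, hu⟩ := hfin
    obtain ⟨y, hy, hleast⟩ :=
      exists_least hF hd ht hcmp (hF.2.2.2.2.1 _ hx) ⟨u, (hmem u).2 hu⟩
    refine ⟨y, (hmem y).1 hy, ?_⟩
    rintro ⟨z, hxz, hzy, hyz⟩
    rcases hleast z ((hmem z).2 hxz) with rfl | h
    exacts [hyz hzy, hyz h]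

/-- A set saturated for the equivalence induced by finitely many internal sets is internal. -/
theorem mem_of_saturated (hF : F.IsGeneral) {G : Set (Set W)} (hG : G.Finite) (hGP : G ⊆ F.P)
    {B : Set W} (hB : ∀ u w, (∀ g ∈ G, u ∈ g ↔ w ∈ g) → u ∈ B → w ∈ B) : B ∈ F.P := by
  have ⟨_, h0, h1, hi, hc, _⟩ := hF
  induction G, hG using Set.Finite.induction_on generalizing B with
  | empty =>
    rcases B.eq_empty_or_nonempty with rfl | ⟨b, hb⟩
    · exact h0
    · rwa [Set.eq_univ_of_forall fun w => hB b w (by simp) hb]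
  | @insert g G _ _ ih =>
    have hg : g ∈ F.P := hGP (.inl rfl)
    have hsat : ∀ S : Set W, {u | ∃ b ∈ B ∩ S, ∀ g ∈ G, b ∈ g ↔ u ∈ g} ∈ F.P := fun S =>
      ih (fun _ h => hGP (.inr h)) fun u w huw ⟨b, hb, hbu⟩ =>
        ⟨b, hb, fun g hg => (hbu g hg).trans (huw g hg)⟩
    have heq : B = (g ∩ {u | ∃ b ∈ B ∩ g, ∀ g ∈ G, b ∈ g ↔ u ∈ g}) ∪
        (gᶜ ∩ {u | ∃ b ∈ B ∩ gᶜ, ∀ g ∈ G, b ∈ g ↔ u ∈ g}) := by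
      ext u
      constructor
      · intro hu
        by_cases hug : u ∈ g
        · exact .inl ⟨hug, u, ⟨hu, hug⟩, fun _ _ => Iff.rfl⟩
        · exact .inr ⟨hug, u, ⟨hu, hug⟩, fun _ _ => Iff.rfl⟩
      · rintro (⟨hug, b, ⟨hb, hbg⟩, hbu⟩ | ⟨hug, b, ⟨hb, hbg⟩, hbu⟩)
        · refine hB b u ?_ hb
          rintro k (rfl | hk)
          exacts [iff_of_true hbg hug, hbu k hk]
        · refine hB b u ?_ hb
          rintro k (rfl | hk)
          exacts [iff_of_false hbg hug, hbu k hk]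
    rw [heq]
    exact hF.union_mem (hi _ hg _ (hsat _)) (hi _ (hc _ hg) _ (hsat _))

theorem cluster_mem_of_lower_mem (hF : F.IsGeneral) (hd : F.Descriptive)
    (ht : ∀ {x y z : W}, F.R x y → F.R y z → F.R x z)
    (hcmp : ∀ y z : W, y = z ∨ F.R y z ∨ F.R z y) (hfg : F.FinGenerated) {x : W}
    (hD : F.lower x ∈ F.P) : F.cluster x ∈ F.P := by
  have ⟨_, _, _, hi, hc, hdia⟩ := hF
  by_cases hx : F.R x x
  · obtain ⟨G, hGfin, hG⟩ := hfg
    have hGP : G ⊆ F.P := fun g hg => by rw [hG]; exact .basic hg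
    have hcl : ∀ {c}, c ∈ F.cluster x → F.R x c ∧ F.R c x := fun {c} h =>
      h.elim (fun e => by rw [e]; exact ⟨hx, hx⟩) id
    have hlow : ∀ {u}, u ∈ F.lower x → F.R u x := fun {u} h =>
      h.elim (fun e => by rw [e]; exact hx) id
    set B : Set W := {u | ∃ c ∈ F.cluster x, ∀ g ∈ G, u ∈ g ↔ c ∈ g} with hBdef
    have hB : B ∈ F.P := mem_of_saturated hF hGfin hGP fun u w huw ⟨c, hcx, huc⟩ =>
      ⟨c, hcx, fun g hg => (huw g hg).symm.trans (huc g hg)⟩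
    set Q : Set W := F.lower x ∩ Bᶜ with hQdef
    have hQ : Q ∈ F.P := hi _ hD _ (hc _ hB)
    set S : Set W := F.lower x ∩ (Q ∪ F.dia Q)ᶜ with hSdef
    have hS : S ∈ F.P := hi _ hD _ (hc _ (hF.union_mem hQ (hdia _ hQ)))
    have hSB : ∀ u ∈ S, u ∈ B := fun u hu => by
      by_contra h
      exact hu.2 (.inl ⟨hu.1, h⟩)
    have hCS : F.cluster x ⊆ S := by
      intro c hcx
      refine ⟨.inr (hcl hcx).2, ?_⟩
      rintro (h | ⟨w, hw, hcw⟩)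
      · exact h.2 ⟨c, hcx, fun _ _ => Iff.rfl⟩
      · exact hw.2 ⟨w, .inr ⟨ht (hcl hcx).1 hcw, hlow hw.1⟩, fun _ _ => Iff.rfl⟩
    have hdiaS : ∀ Z : Set W,
        (∀ u ∈ S, ∀ w ∈ S, (∀ g ∈ G, u ∈ g ↔ w ∈ g) → u ∈ Z → w ∈ Z) →
        ∀ u ∈ S, ∀ w ∈ S, (∃ y ∈ Z, F.R u y) → ∃ y ∈ Z, F.R w y := by
      rintro Z ih u hu w hw ⟨z, hz, huz⟩
      by_cases hzx : z ∈ F.lower x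
      · have hzS : z ∈ S := by
          refine ⟨hzx, ?_⟩
          rintro (h | ⟨q, hq, hzq⟩)
          exacts [hu.2 (.inr ⟨z, h, huz⟩), hu.2 (.inr ⟨q, hq, ht huz hzq⟩)]
        obtain ⟨c, hcx, hzc⟩ := hSB z hzS
        exact ⟨c, ih z hzS c (hCS hcx) hzc hz, ht (hlow hw.1) (hcl hcx).1⟩
      · refine ⟨z, hz, ?_⟩
        rcases hcmp x z with rfl | h | h
        exacts [(hzx (.inl rfl)).elim, ht (hlow hw.1) h, (hzx (.inr h)).elim]
    have hinv : ∀ Z, genBy F.R G Z →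
        ∀ u ∈ S, ∀ w ∈ S, (∀ g ∈ G, u ∈ g ↔ w ∈ g) → u ∈ Z → w ∈ Z := by
      intro Z hZ
      induction hZ with
      | basic hg => exact fun u _ w _ huw => (huw _ hg).1
      | empty => exact fun u _ w _ _ h => h
      | univ => exact fun u _ w _ _ h => h
      | inter _ _ ih₁ ih₂ =>
        exact fun u hu w hw huw h => ⟨ih₁ u hu w hw huw h.1, ih₂ u hu w hw huw h.2⟩
      | compl _ ih =>
        exact fun u hu w hw huw h h' => h (ih w hw u hu (fun g hg => (huw g hg).symm) h')
      | dia _ ih => exact fun u hu w hw _ h => hdiaS _ ih u hu w hw h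
    have hSC : S ⊆ F.cluster x := by
      intro u hu
      obtain ⟨c, hcx, huc⟩ := hSB u hu
      have huv : u = c := hd.1 u c fun X hX => by
        rw [hG] at hX
        exact ⟨hinv X hX u hu c (hCS hcx) huc,
          hinv X hX c (hCS hcx) u hu fun g hg => (huc g hg).symm⟩
      rwa [huv]
    rwa [hCS.antisymm hSC]
  · have heq : F.cluster x = F.lower x ∩ (F.dia (F.lower x))ᶜ := by
      ext y
      constructor
      · rintro (rfl | ⟨h, h'⟩)
        · refine ⟨.inl rfl, ?_⟩
          rintro ⟨z, rfl | hz, hyz⟩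
          exacts [hx hyz, hx (ht hyz hz)]
        · exact (hx (ht h h')).elim
      · rintro ⟨rfl | h, h'⟩
        · exact .inl rfl
        · exact (h' ⟨x, .inl rfl, h⟩).elim
    rw [heq]
    exact hi _ hD _ (hc _ (hdia _ hD))

end KFrame

namespace KModel

variable {W : Type} {M : KModel W}

theorem IsModel.setOf_sat_mem (hM : M.IsModel) (φ : MF) : {x | M.sat x φ} ∈ M.F.P := by
  obtain ⟨⟨_, h0, h1, hi, hc, hdia⟩, hv⟩ := hM
  induction φ with
  | var p => exact hv p
  | top => exact h1
  | bot => exact h0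
  | neg φ ih => exact hc _ ih
  | and φ ψ ihφ ihψ => exact hi _ ihφ _ ihψ
  | dia φ ih =>
    convert hdia _ ih using 1
    ext x
    exact exists_congr fun y => and_comm

theorem definable_iff_mem (hM : M.IsModel) (hg : M.MGenerated) {X : Set W} :
    M.Definable X ↔ X ∈ M.F.P :=
  ⟨fun ⟨φ, h⟩ => h ▸ hM.setOf_sat_mem φ, hg X⟩

theorem clMax_iff (hM : M.IsModel) (hg : M.MGenerated) {x : W} :
    M.ClMax x ↔ ∃ X ∈ M.F.P, ∃ z ∈ M.F.cluster x, M.F.MaxIn X z := by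
  constructor
  · rintro ⟨μ, z, hz, h⟩
    exact ⟨_, hM.setOf_sat_mem μ, z, hz, h.1 μ rfl,
      fun y hzy hy => h.2 y hzy (by rintro γ rfl; exact hy)⟩
  · rintro ⟨X, hX, z, hz, h⟩
    obtain ⟨μ, rfl⟩ := hg X hX
    exact ⟨μ, z, hz, by rintro γ rfl; exact h.1, fun y hzy hy => h.2 y hzy (hy μ rfl)⟩

end KModel

/-- In a model based on a rooted finitely `M`-generated descriptive frame
for `K4.3`: (a) degenerate clusters are maximal; (b) a cluster is maximal iff it is final
or has an immediate successor; (c) a cluster is definable iff it is maximal; hence limit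
clusters are neither definable nor degenerate, and non-limit clusters are definable. -/
theorem cluster_maximality_definability (W : Type) (M : KModel W) (hM : M.IsModel)
    (hroot : ∃ r, M.F.Rooted r) (hd : M.F.Descriptive) (hfg : M.FinMGenerated)
    (hK : M.F.IsFrameFor K43) :
    (∀ x : W, ¬ M.F.R x x → M.ClMax x) ∧
    (∀ x : W, M.ClMax x ↔ (M.F.FinalCl x ∨ ∃ y, M.F.ImmSucc x y)) ∧
    (∀ x : W, M.ClDefinable x ↔ M.ClMax x) ∧
    (∀ x : W, M.F.LimitCl x → ¬ M.ClDefinable x ∧ M.F.R x x) ∧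
    (∀ x : W, ¬ M.F.LimitCl x → M.ClDefinable x) := by
  have hF := hM.1
  obtain ⟨hg, hfin⟩ := hfg
  have ht : ∀ {x y z : W}, M.F.R x y → M.F.R y z → M.F.R x z := hK.transitive hF hd
  have hcmp := hK.comparable hF hd hroot
  have hmax : ∀ x, M.ClMax x ↔ M.F.lower x ∈ M.F.P := fun x => by
    rw [KModel.clMax_iff hM hg]
    constructor
    · rintro ⟨X, hX, z, hz, h⟩
      exact KFrame.lower_mem_of_maxIn hF ht hcmp hX hz h
    · exact fun h => ⟨_, h, x, .inl rfl, KFrame.maxIn_of_lower⟩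
  have hself : ∀ {x}, (∃ X ∈ M.F.P, M.F.MaxIn X x) → M.ClMax x := fun {x} ⟨X, hX, h⟩ =>
    (KModel.clMax_iff hM hg).2 ⟨X, hX, x, .inl rfl, h⟩
  have ha : ∀ x : W, ¬ M.F.R x x → M.ClMax x := fun x hx =>
    hself (KFrame.exists_maxIn_of_irrefl hd hx)
  have hb : ∀ x : W, M.ClMax x ↔ (M.F.FinalCl x ∨ ∃ y, M.F.ImmSucc x y) := by
    refine fun x => ⟨fun h => KFrame.final_or_immSucc_of_lower_mem hF hd ht hcmp ((hmax x).1 h), ?_⟩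
    rintro (h | ⟨y, h⟩)
    · exact hself ⟨Set.univ, hF.2.2.1, trivial, fun y hxy _ => not_not.1 fun hyx => h y ⟨hxy, hyx⟩⟩
    · exact hself (h.exists_maxIn hF hd hcmp)
  have hc : ∀ x : W, M.ClDefinable x ↔ M.ClMax x := fun x => by
    rw [KModel.ClDefinable, KModel.definable_iff_mem hM hg]
    refine ⟨fun h => hself ⟨_, h, .inl rfl, fun y hxy hy => ?_⟩, fun h =>
      KFrame.cluster_mem_of_lower_mem hF hd ht hcmp hfin ((hmax x).1 h)⟩
    exact hy.elim (fun e => by rwa [e] at hxy ⊢) And.right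
  refine ⟨ha, hb, hc, fun x hx => ?_, fun x hx => ?_⟩
  · have hnm : ¬ M.ClMax x := fun h => ((hb x).1 h).elim hx.1 hx.2
    exact ⟨fun h => hnm ((hc x).1 h), not_not.1 fun h => hnm (ha x h)⟩
  · rw [hc, hb]
    by_contra! h
    exact hx ⟨h.1, fun ⟨y, hy⟩ => h.2 y hy⟩
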